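/- A signed graph (G,Σ) admits a proper k-colouring if and only if it admits an s-homomorphism to the signed graph (Z_k, Υ_k), and it admits a proper zero-free k-colouring if and only if it admits an s-homomorphism to (Z*_k, Υ*_k). -/

import Mathlib

structure SignedGraph (V : Type*) where
  pos : V → V → Prop
  neg : V → V → Prop
  pos_symm : ∀ {a b}, pos a b → pos b a
  neg_symm : ∀ {a b}, neg a b → neg b a

/-- Switching the signed graph `G` on the vertex set `X`: edges with exactly one
endpoint in `X` change sign; other edges (including loops) keep their sign. -/
def SignedGraph.switch {V : Type*} (G : SignedGraph V) (X : Set V) : SignedGraph V where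
  pos a b := (((a ∈ X) ↔ (b ∈ X)) ∧ G.pos a b) ∨ (¬((a ∈ X) ↔ (b ∈ X)) ∧ G.neg a b)
  neg a b := (((a ∈ X) ↔ (b ∈ X)) ∧ G.neg a b) ∨ (¬((a ∈ X) ↔ (b ∈ X)) ∧ G.pos a b)
  pos_symm := by
    rintro a b (⟨h1, h2⟩ | ⟨h1, h2⟩)
    · exact Or.inl ⟨h1.symm, G.pos_symm h2⟩
    · exact Or.inr ⟨fun hc => h1 hc.symm, G.neg_symm h2⟩
  neg_symm := by
    rintro a b (⟨h1, h2⟩ | ⟨h1, h2⟩)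
    · exact Or.inl ⟨h1.symm, G.neg_symm h2⟩
    · exact Or.inr ⟨fun hc => h1 hc.symm, G.pos_symm h2⟩

/-- An ec-homomorphism: a vertex mapping preserving adjacency and edge signs. -/
def IsEcHom {V W : Type*} (G : SignedGraph V) (H : SignedGraph W) (f : V → W) : Prop :=
  (∀ a b, G.pos a b → H.pos (f a) (f b)) ∧ (∀ a b, G.neg a b → H.neg (f a) (f b))

/-- An s-homomorphism: an ec-homomorphism after switching the source on some vertex set. -/
def IsSHom {V W : Type*} (G : SignedGraph V) (H : SignedGraph W) (f : V → W) : Prop :=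
  ∃ X : Set V, IsEcHom (G.switch X) H f

/-- The switching graph `P(G,Σ)`: two copies of each vertex; edges between copies with
equal second component keep the sign, the cross edges get the opposite sign. -/
def switchGraph {V : Type*} (G : SignedGraph V) : SignedGraph (V × Bool) where
  pos p q := (p.2 = q.2 ∧ G.pos p.1 q.1) ∨ (p.2 ≠ q.2 ∧ G.neg p.1 q.1)
  neg p q := (p.2 = q.2 ∧ G.neg p.1 q.1) ∨ (p.2 ≠ q.2 ∧ G.pos p.1 q.1)
  pos_symm := by
    rintro a b (⟨h1, h2⟩ | ⟨h1, h2⟩)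
    · exact Or.inl ⟨h1.symm, G.pos_symm h2⟩
    · exact Or.inr ⟨h1.symm, G.neg_symm h2⟩
  neg_symm := by
    rintro a b (⟨h1, h2⟩ | ⟨h1, h2⟩)
    · exact Or.inl ⟨h1.symm, G.neg_symm h2⟩
    · exact Or.inr ⟨h1.symm, G.pos_symm h2⟩

/-- The signed graph `(Z_k, Υ_k)`: vertices `0, 1, …, k`, a negative digon between
every pair of distinct vertices and a negative loop on each nonzero vertex. -/
def Zgraph (k : ℕ) : SignedGraph (Fin (k + 1)) where
  pos a b := a ≠ b
  neg a b := a ≠ b ∨ a ≠ 0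
  pos_symm h := h.symm
  neg_symm := by
    rintro a b (h | h)
    · exact Or.inl h.symm
    · by_cases hb : b = a
      · subst hb; exact Or.inr h
      · exact Or.inl hb

/-- The signed graph `(Z*_k, Υ*_k)`: vertices `1, …, k`, a negative digon between
every pair of distinct vertices and a negative loop on every vertex. -/
def ZstarGraph (k : ℕ) : SignedGraph (Fin k) where
  pos a b := a ≠ b
  neg _ _ := True
  pos_symm h := h.symm
  neg_symm h := h

/-- A proper `k`-colouring of a signed graph: colours in `{0, ±1, …, ±k}` with
`c u ≠ c v` across positive edges and `c u ≠ -c v` across negative edges. -/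
def IsProperColoring {V : Type*} (G : SignedGraph V) (k : ℕ) (c : V → ℤ) : Prop :=
  (∀ v, |c v| ≤ (k : ℤ)) ∧ (∀ a b, G.pos a b → c a ≠ c b) ∧
    (∀ a b, G.neg a b → c a ≠ -c b)

/-- Switching on the negatively coloured vertices turns a proper colouring `c` into the
map `|c|`, which separates positive edges and sends no negative edge to the pair `(0, 0)`. -/
theorem IsProperColoring.switch_natAbs {V : Type*} {G : SignedGraph V} {k : ℕ} {c : V → ℤ}
    (hc : IsProperColoring G k c) :
    (∀ a b, (G.switch {v | c v < 0}).pos a b → (c a).natAbs ≠ (c b).natAbs) ∧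
      (∀ a b, (G.switch {v | c v < 0}).neg a b →
        (c a).natAbs ≠ (c b).natAbs ∨ (c a).natAbs ≠ 0) := by
  obtain ⟨-, hpos, hneg⟩ := hc
  constructor <;> rintro a b (⟨hX, h⟩ | ⟨hX, h⟩) <;>
    simp only [Set.mem_ofPred_eq] at hX
  · have := hpos a b h
    omega
  · have := hneg a b h
    omega
  · have := hneg a b h
    omega
  · have := hpos a b h
    omega

open Classical in
/-- Negating a map `f` on the switched set `X` gives a proper colouring, provided `f` separates
the positive edges of the switched graph and sends none of its negative edges to `(0, 0)`. -/
theorem isProperColoring_of_switch {V : Type*} {G : SignedGraph V} {k : ℕ} {X : Set V}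
    {f : V → ℕ} (hk : ∀ v, f v ≤ k)
    (hpos : ∀ a b, (G.switch X).pos a b → f a ≠ f b)
    (hneg : ∀ a b, (G.switch X).neg a b → f a ≠ f b ∨ f a ≠ 0) :
    IsProperColoring G k (fun v => if v ∈ X then -(f v : ℤ) else f v) := by
  refine ⟨fun v => ?_, fun a b h => ?_, fun a b h => ?_⟩
  · have := hk v
    dsimp only
    split_ifs <;> simpa using this
  · by_cases hX : a ∈ X ↔ b ∈ X
    · have := hpos a b (Or.inl ⟨hX, h⟩)
      dsimp only
      split_ifs <;> omega
    · have := hneg a b (Or.inr ⟨hX, h⟩)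
      dsimp only
      split_ifs <;> first | omega | tauto
  · by_cases hX : a ∈ X ↔ b ∈ X
    · have := hneg a b (Or.inl ⟨hX, h⟩)
      dsimp only
      split_ifs <;> first | omega | tauto
    · have := hpos a b (Or.inr ⟨hX, h⟩)
      dsimp only
      split_ifs <;> omega

/-- A signed graph admits a proper `k`-colouring iff it admits an s-homomorphism to
`(Z_k, Υ_k)`, and a proper zero-free `k`-colouring iff it admits an s-homomorphism
to `(Z*_k, Υ*_k)`. -/
theorem stmt14 {V : Type*} (G : SignedGraph V) (k : ℕ) :
    ((∃ c, IsProperColoring G k c) ↔ ∃ φ : V → Fin (k + 1), IsSHom G (Zgraph k) φ) ∧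
    ((∃ c, IsProperColoring G k c ∧ ∀ v, c v ≠ 0) ↔
      ∃ φ : V → Fin k, IsSHom G (ZstarGraph k) φ) := by
  constructor <;> constructor
  · rintro ⟨c, hc⟩
    have hk (v : V) : (c v).natAbs < k + 1 := by have := abs_le.mp (hc.1 v); omega
    refine ⟨fun v => ⟨(c v).natAbs, hk v⟩, {v | c v < 0}, ?_, ?_⟩
    · intro a b h
      exact fun e => hc.switch_natAbs.1 a b h (Fin.ext_iff.mp e)
    · intro a b h
      exact (hc.switch_natAbs.2 a b h).imp (· <| Fin.ext_iff.mp ·) (· <| Fin.ext_iff.mp ·)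
  · rintro ⟨φ, X, hpos, hneg⟩
    refine ⟨_, isProperColoring_of_switch (X := X) (f := fun v => φ v)
      (fun v => Fin.is_le (φ v)) (fun a b h => ?_) (fun a b h => ?_)⟩
    · exact fun e => hpos a b h (Fin.ext e)
    · exact (hneg a b h).imp (· <| Fin.ext ·) (· <| Fin.ext ·)
  · rintro ⟨c, hc, h0⟩
    have hk (v : V) : (c v).natAbs - 1 < k := by have := abs_le.mp (hc.1 v); have := h0 v; omega
    refine ⟨fun v => ⟨(c v).natAbs - 1, hk v⟩, {v | c v < 0}, fun a b h => ?_,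
      fun _ _ _ => trivial⟩
    have := hc.switch_natAbs.1 a b h
    have := h0 a
    have := h0 b
    simp only [ZstarGraph, ne_eq, Fin.mk.injEq]
    omega
  · rintro ⟨φ, X, hpos, -⟩
    refine ⟨_, isProperColoring_of_switch (X := X) (f := fun v => φ v + 1)
      (fun v => (φ v).is_lt) (fun a b h => ?_) (fun _ _ _ => Or.inr (Nat.succ_ne_zero _)),
      fun v => ?_⟩
    · exact fun e => hpos a b h (Fin.ext (Nat.succ_injective e))
    · split_ifs <;> omega
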